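/- arXiv:2311.06255 — 3 statements merged into one kernel-verified Lean document; each statement's English description precedes it below -/
import Mathlib

section
/- Let p ≥ 2 and n ≥ 2 be integers and let s ∈ ZMod p. Let μ_s be the probability mass function on (ZMod p)^n obtained by drawing r_1, …, r_{n−1} independently and uniformly at random from ZMod p and setting r_n = s − (r_1 + ⋯ + r_{n−1}). Then for every proper subset J ⊊ {1, …, n}, the pushforward of μ_s under the projection onto the coordinates in J is the uniform distribution on (ZMod p)^J; in particular, this marginal distribution is the same for every secret s, so any observer seeing at most n − 1 of the shares learns no information about s. -/
open scoped BigOperators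

/-- A map whose fibres are permuted transitively by permutations of the domain pushes the
uniform distribution forward to the uniform distribution. -/
theorem PMF.map_uniformOfFintype_of_fiber_perm {α β : Type*} [Fintype α] [Nonempty α]
    [Fintype β] [Nonempty β] (f : α → β)
    (h : ∀ y y', ∃ e : Equiv.Perm α, ∀ a, f (e a) = y' ↔ f a = y) :
    (PMF.uniformOfFintype α).map f = PMF.uniformOfFintype β := by
  classical
  set q := (PMF.uniformOfFintype α).map f with hq
  have hconst : ∀ y y', q y = q y' := by
    intro y y'
    obtain ⟨e, he⟩ := h y y'
    simp only [hq, PMF.map_apply, PMF.uniformOfFintype_apply]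
    rw [← e.tsum_eq (fun a => if y' = f a then ((Fintype.card α : ENNReal))⁻¹ else 0)]
    simp only [eq_comm (a := y'), eq_comm (a := y), he]
  ext y
  have hsum : (Fintype.card β : ENNReal) * q y = 1 := by
    rw [← q.tsum_coe, tsum_fintype, Finset.sum_congr rfl fun z _ => hconst z y]
    simp
  rw [PMF.uniformOfFintype_apply]
  exact ENNReal.eq_inv_of_mul_eq_one_left (by rwa [mul_comm])

/-- Values prescribed on a proper subset of a finite type extend to a function with sum zero. -/
theorem exists_extension_sum_eq_zero {ι A : Type*} [Fintype ι] [AddCommGroup A]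
    (J : Finset ι) (hJ : J ≠ Finset.univ) (y : J → A) :
    ∃ z : ι → A, (∀ j : J, z j = y j) ∧ ∑ i, z i = 0 := by
  classical
  obtain ⟨k, hk⟩ : ∃ k, k ∉ J := by
    simpa [Finset.eq_univ_iff_forall] using hJ
  let w : ι → A := fun i => if h : i ∈ J then y ⟨i, h⟩ else 0
  refine ⟨w - Pi.single k (∑ i, w i), fun j => ?_, ?_⟩
  · have hjk : (j : ι) ≠ k := fun h => hk (h ▸ j.2)
    simp [w, hjk]
  · simp [Finset.sum_sub_distrib]

/-- **Perfect secrecy of additive secret sharing.**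
Let `p ≥ 2` and `n ≥ 2` and `s : ZMod p`. Let `μ` be the distribution on share
tuples obtained by drawing the first `n - 1` shares independently and uniformly
at random from `ZMod p` and setting the last share to `s` minus their sum. Then
for every proper subset `J` of the indices, the marginal of `μ` on the
coordinates in `J` is the uniform distribution on `J → ZMod p`; in particular
it does not depend on the secret `s`. -/
theorem additive_secret_sharing_marginal_uniform
    (p n : ℕ) [NeZero p] (hp : 2 ≤ p) (hn : 2 ≤ n) (s : ZMod p)
    (μ : PMF (Fin n → ZMod p))
    (hμ : μ = (PMF.uniformOfFintype (Fin (n - 1) → ZMod p)).map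
      (fun r => fun i : Fin n =>
        if h : (i : ℕ) < n - 1 then r ⟨i, h⟩ else s - ∑ j, r j))
    (J : Finset (Fin n)) (hJ : J ≠ Finset.univ) :
    μ.map (fun f => fun j : J => f j) =
      PMF.uniformOfFintype (J → ZMod p) := by
  obtain ⟨m, rfl⟩ : ∃ m, n = m + 1 := ⟨n - 1, by lia⟩
  subst hμ
  rw [PMF.map_comp]
  apply PMF.map_uniformOfFintype_of_fiber_perm
  intro y y'
  obtain ⟨z, hz, hz0⟩ := exists_extension_sum_eq_zero J hJ (y' - y)
  rw [Fin.sum_univ_castSucc] at hz0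
  refine ⟨Equiv.addRight (fun i : Fin m => z i.castSucc), fun r => ?_⟩
  simp only [funext_iff, Function.comp_apply]
  refine forall_congr' fun j => ?_
  have hy : y' j = y j + z j := by simp [hz]
  rw [hy]
  rcases j with ⟨j, hj⟩
  induction j using Fin.lastCases with
  | last =>
    have hlast : z (Fin.last m) = -∑ i : Fin m, z i.castSucc :=
      eq_neg_of_add_eq_zero_right hz0
    simp [hlast, Finset.sum_add_distrib, sub_eq_add_neg, ← add_assoc]
    rw [add_right_comm, add_left_inj]
  | cast i => simp
end

section
/- Let p ≥ 2 be an integer modulus and P ∈ ℕ a precision. If x ∈ ℚ satisfies 10^P · x ∈ ℤ and |10^P · x| < p/2, then decoding inverts encoding exactly: dec(enc(x)) = x. -/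
/-- The fixed-point encoding `enc(x) = int(10^P · x) mod p` into `ZMod p`. -/
noncomputable def enc (p P : ℕ) (x : ℝ) : ZMod p :=
  ((⌊(10 : ℝ) ^ P * x⌋ : ℤ) : ZMod p)

/-- The decoding `dec(z) = v / 10^P` if `v ≤ p/2` and `(v - p) / 10^P`
otherwise, where `v ∈ {0, …, p-1}` is the canonical representative of `z`. -/
noncomputable def dec (p P : ℕ) (z : ZMod p) : ℝ :=
  if (z.val : ℝ) ≤ (p : ℝ) / 2 then (z.val : ℝ) / 10 ^ P
  else ((z.val : ℝ) - (p : ℝ)) / 10 ^ P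

/-- Decoding is division of the representative of least absolute value by `10 ^ P`. -/
theorem dec_eq_valMinAbs_div (p P : ℕ) [NeZero p] (z : ZMod p) :
    dec p P z = (z.valMinAbs : ℝ) / 10 ^ P := by
  have h : (z.val : ℝ) ≤ (p : ℝ) / 2 ↔ z.val ≤ p / 2 := by
    rw [Nat.le_div_iff_mul_le two_pos, le_div_iff₀ two_pos]
    exact_mod_cast Iff.rfl
  simp only [dec, ZMod.valMinAbs_def_pos, h]
  split_ifs <;> push_cast <;> rfl

/-- **Decoding inverts encoding.**
Let `p ≥ 2` and `P` a precision. If `x : ℚ` is such that `10^P · x` is an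
integer with `|10^P · x| < p/2`, then `dec(enc(x)) = x`. -/
theorem dec_enc_eq_self
    (p P : ℕ) (hp : 2 ≤ p) (x : ℚ)
    (hint : ∃ k : ℤ, (10 : ℚ) ^ P * x = (k : ℚ))
    (hbound : |(10 : ℚ) ^ P * x| < (p : ℚ) / 2) :
    dec p P (enc p P (x : ℝ)) = (x : ℝ) := by
  obtain ⟨k, hk⟩ := hint
  have : NeZero p := ⟨by omega⟩
  have hkR : (10 : ℝ) ^ P * x = k := by exact_mod_cast congrArg (Rat.cast : ℚ → ℝ) hk
  rw [hk, abs_lt] at hbound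
  have hlo : -(p : ℤ) < k * 2 := by
    have : -(p : ℚ) < k * 2 := by linarith [hbound.1]
    exact_mod_cast this
  have hhi : k * 2 ≤ p := by
    have : (k : ℚ) * 2 ≤ p := by linarith [hbound.2]
    exact_mod_cast this
  have hval : (k : ZMod p).valMinAbs = k :=
    (ZMod.valMinAbs_spec _ _).2 ⟨rfl, hlo, hhi⟩
  rw [enc, hkR, Int.floor_intCast, dec_eq_valMinAbs_div, hval, ← hkR]
  field_simp
end

section
/- Let p ≥ 2 be an integer modulus and P ∈ ℕ a precision. For every real number x with |10^P · x| < p/2 − 1, the quantization error of the encode–decode round trip is bounded by one unit in the last preserved decimal place: |dec(enc(x)) − x| < 10^{−P}. -/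
/-- Decoding recovers every integer in the symmetric range `(-p/2, p/2]`. -/
theorem dec_intCast {p : ℕ} (hp : p ≠ 0) (P : ℕ) {n : ℤ}
    (hlow : -(p : ℤ) < 2 * n) (hupp : 2 * n ≤ p) :
    dec p P (n : ZMod p) = (n : ℝ) / 10 ^ P := by
  have : NeZero p := ⟨hp⟩
  have hval : (((n : ZMod p).val : ℤ) : ℝ) = ((n % p : ℤ) : ℝ) := by rw [ZMod.val_intCast]
  rw [Int.cast_natCast] at hval
  unfold dec
  rw [hval]
  have hupp' : 2 * (n : ℝ) ≤ p := by exact_mod_cast hupp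
  have hlow' : -(p : ℝ) < 2 * n := by exact_mod_cast hlow
  rcases le_or_gt 0 n with hn | hn
  · rw [Int.emod_eq_of_lt hn (by omega), if_pos (by linarith)]
  · have hmod : n % (p : ℤ) = n + p := by
      rw [← Int.add_emod_right, Int.emod_eq_of_lt (by omega) (by omega)]
    rw [hmod]
    push_cast
    rw [if_neg (by linarith), add_sub_cancel_right]

/-- **Quantization error bound of the encode–decode round trip.**
Let `p ≥ 2` and `P` a precision. For every real `x` with
`|10^P · x| < p/2 - 1`, the round-trip error is bounded by one unit in the
last preserved decimal place: `|dec(enc(x)) - x| < 10^(-P)`. -/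
theorem dec_enc_quantization_error
    (p P : ℕ) (hp : 2 ≤ p) (x : ℝ)
    (hbound : |(10 : ℝ) ^ P * x| < (p : ℝ) / 2 - 1) :
    |dec p P (enc p P x) - x| < 1 / 10 ^ P := by
  obtain ⟨hlow, hupp⟩ := abs_lt.mp hbound
  have hfloor := Int.floor_le ((10 : ℝ) ^ P * x)
  have hfloor' := Int.lt_floor_add_one ((10 : ℝ) ^ P * x)
  have hpow : (0 : ℝ) < 10 ^ P := by positivity
  unfold enc
  rw [dec_intCast (by omega) P
    (by rify; linarith) (by rify; linarith)]
  rw [lt_div_iff₀ hpow, ← abs_of_pos hpow, ← abs_mul, abs_of_pos hpow, sub_mul,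
    div_mul_cancel₀ _ hpow.ne', abs_lt]
  constructor <;> linarith
end
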